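/- arXiv:2305.14401 — 2 statements merged into one kernel-verified Lean document; each statement's English description precedes it below -/
import Mathlib

section
/- Let G be a digraph on n ≥ 3 vertices and let P be a digraph on n vertices with distinct vertices u and v such that there is no arc between u and v in P. Suppose Y₁ and Y₂ each belong to the set {P, P+uv, P+vu, P+uv+vu} (adding the indicated arcs between u and v) and that Y₁ and Y₂ are each hypomorphic to G. Then Y₁ and Y₂ have the same number of unpaired arcs and the same number of biarcs; consequently, either Y₁ = Y₂ or {Y₁, Y₂} = {P+uv, P+vu}. -/
/-- An isomorphism between two digraphs (given as arc relations) is a vertex bijection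
preserving the arc relation in both directions. -/
def DIso {V W : Type*} (D : V → V → Prop) (E : W → W → Prop) : Prop :=
  ∃ f : V ≃ W, ∀ x y, D x y ↔ E (f x) (f y)

/-- The card of a digraph `D` obtained by deleting the vertex `v`. -/
def dCard {V : Type*} (D : V → V → Prop) (v : V) :
    {x : V // x ≠ v} → {x : V // x ≠ v} → Prop :=
  fun x y => D x.1 y.1

/-- Two digraphs on `Fin n` are hypomorphic if some bijection of their vertex sets
matches each card of one with an isomorphic card of the other. -/
def DHypomorphic {n : ℕ} (D E : Fin n → Fin n → Prop) : Prop :=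
  ∃ σ : Fin n ≃ Fin n, ∀ v, DIso (dCard D v) (dCard E (σ v))

/-- First degree: the number of out-neighbors of `v`. -/
noncomputable def aDeg {V : Type*} (D : V → V → Prop) (v : V) : ℕ :=
  Nat.card {w : V // D v w ∧ ¬ D w v}

/-- Second degree: the number of in-neighbors of `v`. -/
noncomputable def bDeg {V : Type*} (D : V → V → Prop) (v : V) : ℕ :=
  Nat.card {w : V // D w v ∧ ¬ D v w}

/-- Third degree: the number of strong neighbors of `v`. -/
noncomputable def cDeg {V : Type*} (D : V → V → Prop) (v : V) : ℕ :=
  Nat.card {w : V // D v w ∧ D w v}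

/-- The degree triple of a vertex. -/
noncomputable def degTriple {V : Type*} (D : V → V → Prop) (v : V) : ℕ × ℕ × ℕ :=
  (aDeg D v, bDeg D v, cDeg D v)

/-- Two digraphs on `Fin n` are da-hypomorphic if some bijection of their vertex sets
matches each card of one with an isomorphic card of the other, the deleted vertices
having the same degree triple. -/
def DaHypomorphic {n : ℕ} (D E : Fin n → Fin n → Prop) : Prop :=
  ∃ σ : Fin n ≃ Fin n, ∀ v, DIso (dCard D v) (dCard E (σ v)) ∧
    degTriple D v = degTriple E (σ v)

/-- The digraph obtained from `P` by adding the arc `uv`. -/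
def addArc {V : Type*} (P : V → V → Prop) (u v : V) : V → V → Prop :=
  fun x y => P x y ∨ (x = u ∧ y = v)

/-- The number of unpaired arcs of a digraph on `Fin n`. -/
noncomputable def unpairedArcCount {n : ℕ} (D : Fin n → Fin n → Prop) : ℕ :=
  Nat.card {p : Fin n × Fin n // D p.1 p.2 ∧ ¬ D p.2 p.1}

/-- The number of biarcs (symmetric pairs of arcs) of a digraph on `Fin n`. -/
noncomputable def biarcCount {n : ℕ} (D : Fin n → Fin n → Prop) : ℕ :=
  Nat.card {p : Fin n × Fin n // p.1 < p.2 ∧ D p.1 p.2 ∧ D p.2 p.1}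

/-- The number of arcs of a digraph. -/
noncomputable def arcCount {V : Type*} (D : V → V → Prop) : ℕ :=
  Nat.card {p : V × V // D p.1 p.2}

theorem DIso.arcCount_eq {V W : Type*} {D : V → V → Prop} {E : W → W → Prop}
    (h : DIso D E) : arcCount D = arcCount E := by
  obtain ⟨f, hf⟩ := h
  exact Nat.card_congr ((f.prodCongr f).subtypeEquiv fun p => hf p.1 p.2)

open Classical in
theorem arcCount_dCard {n : ℕ} (D : Fin n → Fin n → Prop) (w : Fin n) :
    arcCount (dCard D w) =
      (Finset.univ.filter fun p : Fin n × Fin n =>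
        D p.1 p.2 ∧ p.1 ≠ w ∧ p.2 ≠ w).card := by
  rw [← Fintype.card_subtype, ← Nat.card_eq_fintype_card]
  exact Nat.card_congr
    { toFun := fun p => ⟨(p.1.1.1, p.1.2.1), p.2, p.1.1.2, p.1.2.2⟩
      invFun := fun p => ⟨(⟨p.1.1, p.2.2.1⟩, ⟨p.1.2, p.2.2.2⟩), p.2.1⟩
      left_inv := fun _ => rfl
      right_inv := fun _ => rfl }

/-- Each arc of a loopless digraph survives in all cards but the two at its ends. -/
theorem sum_arcCount_dCard {n : ℕ} {D : Fin n → Fin n → Prop} (hD : Irreflexive D) :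
    ∑ w, arcCount (dCard D w) = arcCount D * (n - 2) := by
  classical
  have hcount : arcCount D =
      (Finset.univ.filter fun p : Fin n × Fin n => D p.1 p.2).card := by
    rw [arcCount, Nat.card_eq_fintype_card, Fintype.card_subtype]
  have hswap := Finset.sum_card_bipartiteAbove_eq_sum_card_bipartiteBelow
    (s := (Finset.univ : Finset (Fin n)))
    (t := Finset.univ.filter fun p : Fin n × Fin n => D p.1 p.2)
    (fun w p => p.1 ≠ w ∧ p.2 ≠ w)
  simp only [Finset.bipartiteAbove, Finset.bipartiteBelow, Finset.filter_filter] at hswap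
  simp only [arcCount_dCard]
  rw [hswap, hcount]
  apply Finset.sum_const_nat
  intro p hp
  have hne : p.1 ≠ p.2 := by
    intro h
    have hp' := (Finset.mem_filter.mp hp).2
    rw [h] at hp'
    exact hD _ hp'
  have hset : (Finset.univ.filter fun w : Fin n => p.1 ≠ w ∧ p.2 ≠ w) =
      ({p.1, p.2} : Finset (Fin n))ᶜ := by
    ext w
    simp [eq_comm]
  rw [hset, Finset.card_compl, Finset.card_pair hne, Fintype.card_fin]

theorem DHypomorphic.arcCount_eq {n : ℕ} (hn : 3 ≤ n) {D E : Fin n → Fin n → Prop}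
    (hD : Irreflexive D) (hE : Irreflexive E) (h : DHypomorphic D E) :
    arcCount D = arcCount E := by
  obtain ⟨σ, hσ⟩ := h
  have hsum : ∑ w, arcCount (dCard D w) = ∑ w, arcCount (dCard E w) := by
    rw [← Equiv.sum_comp σ fun w => arcCount (dCard E w)]
    exact Finset.sum_congr rfl fun w _ => (hσ w).arcCount_eq
  rw [sum_arcCount_dCard hD, sum_arcCount_dCard hE] at hsum
  exact Nat.eq_of_mul_eq_mul_right (by omega) hsum

theorem DHypomorphic.unpairedArcCount_eq {n : ℕ} (hn : 3 ≤ n)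
    {D E : Fin n → Fin n → Prop} (h : DHypomorphic D E) :
    unpairedArcCount D = unpairedArcCount E := by
  obtain ⟨σ, hσ⟩ := h
  refine DHypomorphic.arcCount_eq (D := fun x y => D x y ∧ ¬ D y x)
    (E := fun x y => E x y ∧ ¬ E y x) hn (fun _ hx => hx.2 hx.1) (fun _ hx => hx.2 hx.1)
    ⟨σ, fun w => ?_⟩
  obtain ⟨f, hf⟩ := hσ w
  exact ⟨f, fun x y => and_congr (hf x y) (not_congr (hf y x))⟩

theorem addArc_irreflexive {V : Type*} {P : V → V → Prop} (hP : Irreflexive P) {u v : V}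
    (huv : u ≠ v) : Irreflexive (addArc P u v) := by
  rintro x (h | ⟨rfl, h⟩)
  · exact hP x h
  · exact huv h

theorem arcCount_addArc {V : Type*} [Finite V] {P : V → V → Prop} {u v : V}
    (h : ¬ P u v) : arcCount (addArc P u v) = arcCount P + 1 := by
  have hset : {p : V × V | addArc P u v p.1 p.2} = insert (u, v) {p | P p.1 p.2} := by
    ext ⟨x, y⟩
    simp [addArc, or_comm]
  change Set.ncard {p : V × V | addArc P u v p.1 p.2} = Set.ncard {p : V × V | P p.1 p.2} + 1
  rw [hset]
  exact Set.ncard_insert_of_notMem h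

theorem biarcCount_addArc {n : ℕ} {P : Fin n → Fin n → Prop} {u v : Fin n}
    (huv : u ≠ v) (h : ¬ P v u) : biarcCount (addArc P u v) = biarcCount P := by
  refine Nat.card_congr (Equiv.subtypeEquivRight fun p => and_congr_right fun _ => ?_)
  simp only [addArc]
  grind

/-- Lemma 4.10: if `Y₁` and `Y₂` are obtained from `P` by adding arcs (possibly none)
between the nonadjacent vertices `u ≠ v` and both are hypomorphic to `G`, then `Y₁`
and `Y₂` have the same number of unpaired arcs and of biarcs; consequently either
`Y₁ = Y₂` or `{Y₁, Y₂} = {P + uv, P + vu}`. -/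
theorem stmt10 {n : ℕ} (hn : 3 ≤ n) (G P : Fin n → Fin n → Prop)
    (hG : Irreflexive G) (hP : Irreflexive P)
    (u v : Fin n) (huv : u ≠ v) (hPuv : ¬ P u v) (hPvu : ¬ P v u)
    (Y₁ Y₂ : Fin n → Fin n → Prop)
    (hY₁ : Y₁ ∈ ({P, addArc P u v, addArc P v u, addArc (addArc P u v) v u} :
      Set (Fin n → Fin n → Prop)))
    (hY₂ : Y₂ ∈ ({P, addArc P u v, addArc P v u, addArc (addArc P u v) v u} :
      Set (Fin n → Fin n → Prop)))
    (hH₁ : DHypomorphic Y₁ G) (hH₂ : DHypomorphic Y₂ G) :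
    unpairedArcCount Y₁ = unpairedArcCount Y₂ ∧
    biarcCount Y₁ = biarcCount Y₂ ∧
    (Y₁ = Y₂ ∨ ({Y₁, Y₂} : Set (Fin n → Fin n → Prop)) = {addArc P u v, addArc P v u}) := by
  have hvu : ¬ addArc P u v v u := by
    rintro (h | ⟨h, -⟩)
    · exact hPvu h
    · exact huv h.symm
  have hIrr : ∀ Y ∈ ({P, addArc P u v, addArc P v u, addArc (addArc P u v) v u} :
      Set (Fin n → Fin n → Prop)), Irreflexive Y := by
    rintro Y (rfl | rfl | rfl | rfl)
    · exact hP
    · exact addArc_irreflexive hP huv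
    · exact addArc_irreflexive hP huv.symm
    · exact addArc_irreflexive (addArc_irreflexive hP huv) huv.symm
  have hArc : arcCount Y₁ = arcCount Y₂ :=
    (hH₁.arcCount_eq hn (hIrr Y₁ hY₁) hG).trans (hH₂.arcCount_eq hn (hIrr Y₂ hY₂) hG).symm
  refine ⟨(hH₁.unpairedArcCount_eq hn).trans (hH₂.unpairedArcCount_eq hn).symm, ?_⟩
  have huvCount := arcCount_addArc hPuv
  have hvuCount := arcCount_addArc hPvu
  have hbothCount := arcCount_addArc hvu
  have huvBi := biarcCount_addArc huv hPvu
  have hvuBi := biarcCount_addArc huv.symm hPuv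
  rcases hY₁ with rfl | rfl | rfl | rfl <;> rcases hY₂ with rfl | rfl | rfl | rfl <;>
    first
    | exact ⟨rfl, Or.inl rfl⟩
    | omega
    | exact ⟨huvBi.trans hvuBi.symm, Or.inr rfl⟩
    | exact ⟨hvuBi.trans huvBi.symm, Or.inr (Set.pair_comm _ _)⟩
end

section
/- Let G be a digraph and let H₁ and H₂ be digraphs each da-hypomorphic to G. Suppose there exist distinct vertices u₁, v₁ of H₁ and distinct vertices u₂, v₂ of H₂ and an isomorphism φ from P₁ to P₂ (where Pᵢ is Hᵢ with all arcs between uᵢ and vᵢ deleted) such that φ({u₁, v₁}) = {u₂, v₂} and dt_{H₁}(x) = dt_{H₂}(φ(x)) for each x ∈ {u₁, v₁}. Then H₁ is isomorphic to H₂. -/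
/-- The digraph obtained from `D` by deleting all arcs between `u` and `v`. -/
def delPair {V : Type*} (D : V → V → Prop) (u v : V) : V → V → Prop :=
  fun x y => D x y ∧ ¬((x = u ∧ y = v) ∨ (x = v ∧ y = u))

/-- Two predicates on a finite type that agree away from `v` and hold equally often agree at `v`. -/
theorem iff_of_card_eq_of_iff_off {V : Type*} [Finite V] {p q : V → Prop} {v : V}
    (hoff : ∀ w, w ≠ v → (p w ↔ q w))
    (hcard : Nat.card {w : V // p w} = Nat.card {w : V // q w}) : p v ↔ q v := by
  have key : ∀ {p q : V → Prop}, (∀ w, w ≠ v → (p w ↔ q w)) →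
      Nat.card {w : V // p w} = Nat.card {w : V // q w} → p v → q v := by
    intro p q hoff hcard hp
    by_contra hq
    have hss : {w | q w} ⊂ {w | p w} := by
      refine ⟨fun w hw => ?_, fun h => hq (h hp)⟩
      by_cases hwv : w = v
      · exact hwv ▸ hp
      · exact (hoff w hwv).2 hw
    exact (Set.ncard_lt_ncard hss (Set.toFinite _)).ne' hcard
  exact ⟨key hoff hcard, key (fun w hw => (hoff w hw).symm) hcard.symm⟩

/-- Degree triples are invariant under relabelling the vertices by a bijection. -/
theorem degTriple_comap {V W : Type*} (E : W → W → Prop) (f : V ≃ W) (v : V) :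
    degTriple (fun x y => E (f x) (f y)) v = degTriple E (f v) := by
  refine Prod.ext ?_ (Prod.ext ?_ ?_) <;>
    exact Nat.card_congr (f.subtypeEquiv fun _ => Iff.rfl)

/-- If two digraphs agree on all pairs containing `u` other than `u, v`, and `u` has the same
degree triple in both, then they agree on the pair `u, v` as well. -/
theorem arcs_iff_of_degTriple_eq {V : Type*} [Finite V] {D E : V → V → Prop} {u v : V}
    (hout : ∀ w, w ≠ v → (D u w ↔ E u w)) (hin : ∀ w, w ≠ v → (D w u ↔ E w u))
    (hdt : degTriple D u = degTriple E u) : (D u v ↔ E u v) ∧ (D v u ↔ E v u) := by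
  simp only [degTriple, Prod.mk.injEq] at hdt
  obtain ⟨ha, hb, hc⟩ := hdt
  have ha' := iff_of_card_eq_of_iff_off (v := v)
    (fun w hw => and_congr (hout w hw) (not_congr (hin w hw))) ha
  have hb' := iff_of_card_eq_of_iff_off (v := v)
    (fun w hw => and_congr (hin w hw) (not_congr (hout w hw))) hb
  have hc' := iff_of_card_eq_of_iff_off (v := v)
    (fun w hw => and_congr (hout w hw) (hin w hw)) hc
  tauto

/-- Corollary 5.4: if `H₁` and `H₂` are da-hypomorphs of a digraph `G` and some
dapasting is a dapasting in both of them — i.e. there is an isomorphism from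
`P₁ = H₁` minus the arcs between `u₁, v₁` to `P₂ = H₂` minus the arcs between
`u₂, v₂` carrying `{u₁, v₁}` onto `{u₂, v₂}` and preserving the degree triples
of `u₁` and `v₁` — then `H₁ ≅ H₂`. -/
theorem stmt15 {n : ℕ} (G H₁ H₂ : Fin n → Fin n → Prop)
    (hG : Irreflexive G) (hH₁ : Irreflexive H₁) (hH₂ : Irreflexive H₂)
    (hda₁ : DaHypomorphic H₁ G) (hda₂ : DaHypomorphic H₂ G)
    (u₁ v₁ : Fin n) (h₁ : u₁ ≠ v₁) (u₂ v₂ : Fin n) (h₂ : u₂ ≠ v₂)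
    (φ : Fin n ≃ Fin n)
    (hφ : ∀ x y, delPair H₁ u₁ v₁ x y ↔ delPair H₂ u₂ v₂ (φ x) (φ y))
    (hset : ({φ u₁, φ v₁} : Set (Fin n)) = {u₂, v₂})
    (hdtu : degTriple H₁ u₁ = degTriple H₂ (φ u₁))
    (hdtv : degTriple H₁ v₁ = degTriple H₂ (φ v₁)) :
    DIso H₁ H₂ := by
  have hoff : ∀ x y, ¬((x = u₁ ∧ y = v₁) ∨ (x = v₁ ∧ y = u₁)) →
      (H₁ x y ↔ H₂ (φ x) (φ y)) := by
    intro x y hxy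
    have hxy' : ¬((φ x = u₂ ∧ φ y = v₂) ∨ (φ x = v₂ ∧ φ y = u₂)) := by
      rcases Set.pair_eq_pair_iff.1 hset with ⟨rfl, rfl⟩ | ⟨rfl, rfl⟩ <;>
        simp only [φ.apply_eq_iff_eq] <;> tauto
    have h := hφ x y
    simp only [delPair] at h
    tauto
  have hpair := arcs_iff_of_degTriple_eq (D := H₁) (E := fun x y => H₂ (φ x) (φ y))
    (u := u₁) (v := v₁) (fun w hw => hoff _ _ (by tauto)) (fun w hw => hoff _ _ (by tauto))
    (hdtu.trans (degTriple_comap H₂ φ u₁).symm)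
  refine ⟨φ, fun x y => ?_⟩
  by_cases hxy : (x = u₁ ∧ y = v₁) ∨ (x = v₁ ∧ y = u₁)
  · rcases hxy with ⟨rfl, rfl⟩ | ⟨rfl, rfl⟩
    exacts [hpair.1, hpair.2]
  · exact hoff x y hxy
end
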